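/- arXiv:0905.3580 — 3 statements merged into one kernel-verified Lean document; each statement's English description precedes it below -/
import Mathlib

section
/- Let l be a field and let X be a scheme which is reduced, connected (hence nonempty) and of finite type over l. Then the ring A = O_X(X) of global sections contains a largest subfield: there exists a subring k of A which is a field and such that every subring of A which is a field is contained in k. In particular, every ring homomorphism from a field into A has image contained in k. -/
open AlgebraicGeometry Opposite

/-- A reduced algebra over a field which is integral and has only trivial idempotents is a field. -/
theorem isField_of_isIntegral_of_isIdempotentElem {K B : Type*} [Field K] [CommRing B]
    [Algebra K B] [Nontrivial B] [IsReduced B] [Algebra.IsIntegral K B]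
    (h : ∀ e : B, IsIdempotentElem e → e = 0 ∨ e = 1) : IsField B := by
  refine ⟨exists_pair_ne B, mul_comm, fun {b} hb ↦ ?_⟩
  obtain ⟨P, hP, hPb⟩ := (Algebra.IsIntegral.isIntegral (R := K) b).isAlgebraic
  obtain ⟨Q, hPQ, hQ⟩ := Polynomial.exists_eq_pow_rootMultiplicity_mul_and_not_dvd P hP 0
  rw [Polynomial.C_0, sub_zero] at hPQ hQ
  set n := P.rootMultiplicity 0
  obtain ⟨u, v, huv⟩ : IsCoprime (Polynomial.X ^ (n + 1)) Q :=
    ((Polynomial.irreducible_X.coprime_iff_not_dvd).2 hQ).pow_left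
  have huv' := congrArg (Polynomial.aeval b) huv
  rw [hPQ] at hPb
  simp only [map_add, map_mul, map_pow, Polynomial.aeval_X, map_one] at huv' hPb
  set U := Polynomial.aeval b u
  set V := Polynomial.aeval b v
  set W := Polynomial.aeval b Q
  have he : IsIdempotentElem (U * b ^ (n + 1)) := by
    unfold IsIdempotentElem
    linear_combination (U * b ^ (n + 1)) * huv' - U * V * b * hPb
  rcases h _ he with h0 | h1
  · refine (hb (eq_zero_of_pow_eq_zero (n := n) ?_)).elim
    linear_combination b ^ n * h0 - b ^ n * huv' + V * hPb
  · exact ⟨U * b ^ n, by linear_combination h1⟩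

/-- A nonzero polynomial over a field is nonzero at some root of unity of the algebraic closure. -/
theorem Polynomial.exists_pow_eq_one_aeval_ne_zero {K : Type*} [Field K] {g : Polynomial K}
    (hg : g ≠ 0) : ∃ (N : ℕ) (θ : AlgebraicClosure K), 0 < N ∧ θ ^ N = 1 ∧ aeval θ g ≠ 0 := by
  obtain ⟨N, hN, hN0⟩ : ∃ N : ℕ, g.natDegree < N ∧ (N : AlgebraicClosure K) ≠ 0 := by
    by_contra! H
    have h1 := H (g.natDegree + 1) (by lia)
    have h2 := H (g.natDegree + 2) (by lia)
    push_cast at h1 h2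
    exact one_ne_zero (α := AlgebraicClosure K) (by linear_combination h2 - h1)
  have : NeZero (N : AlgebraicClosure K) := ⟨hN0⟩
  have : NeZero (N : K) := ⟨fun h ↦ hN0 (by
    rw [← map_natCast (algebraMap K (AlgebraicClosure K)), h, map_zero])⟩
  obtain ⟨ζ, hζ⟩ := HasEnoughRootsOfUnity.exists_primitiveRoot (AlgebraicClosure K) N
  by_contra! H
  have hg' : g.map (algebraMap K (AlgebraicClosure K)) ≠ 0 :=
    (Polynomial.map_ne_zero_iff (algebraMap K (AlgebraicClosure K)).injective).2 hg
  have hsub : (Polynomial.nthRootsFinset N (1 : AlgebraicClosure K)).val ⊆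
      (g.map (algebraMap K (AlgebraicClosure K))).roots := by
    intro θ hθ
    rw [Finset.mem_val, Polynomial.mem_nthRootsFinset (by lia)] at hθ
    rw [Polynomial.mem_roots hg', Polynomial.IsRoot, Polynomial.eval_map_algebraMap]
    exact H N θ (by lia) hθ
  have hcard := Polynomial.card_le_degree_of_subset_roots hsub
  rw [hζ.card_nthRootsFinset, Polynomial.natDegree_map] at hcard
  lia

/-- If `D → S` is injective and of finite type and `D` is a Noetherian domain, then the image of
`Spec S → Spec D` contains a nonempty basic open set. -/
theorem PrimeSpectrum.exists_basicOpen_subset_range_comap {D S : Type*} [CommRing D] [IsDomain D]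
    [IsNoetherianRing D] [CommRing S] {φ : D →+* S} (hφ : φ.FiniteType)
    (hinj : Function.Injective φ) :
    ∃ g : D, g ≠ 0 ∧ (basicOpen g : Set (PrimeSpectrum D)) ⊆ Set.range (comap φ) := by
  obtain ⟨C, hC⟩ := exists_constructibleSetData_iff.2
    (isConstructible_range_comap (RingHom.FinitePresentation.of_finiteType.1 hφ))
  have hgen : (⊥ : PrimeSpectrum D) ∈ Set.range (comap φ) := by
    refine (denseRange_comap_iff_minimalPrimes φ).1
      ((denseRange_comap_iff_ker_le_nilRadical φ).2 ?_) ⊥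
      (by simp [IsDomain.minimalPrimes_eq_singleton_bot])
    rw [(RingHom.injective_iff_ker_eq_bot φ).1 hinj]
    exact bot_le
  rw [← hC] at hgen
  obtain ⟨c, hc, hmem⟩ : ∃ c ∈ C, (⊥ : PrimeSpectrum D) ∈ c.toSet := by
    simpa [ConstructibleSetData.toSet] using hgen
  obtain ⟨h1, h2⟩ := hmem
  refine ⟨c.f, fun h ↦ h2 (by simp [h]), ?_⟩
  rw [← hC]
  intro p hp
  refine Set.mem_biUnion hc ⟨fun x hx ↦ ?_, fun h ↦ hp (by simpa using h)⟩
  have : x = 0 := by simpa using h1 hx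
  simp [this]

/-- An element `a` of a finite type algebra over a field such that each `a ^ N - 1` with `0 < N` is
zero or a unit is algebraic. -/
theorem isAlgebraic_of_pow_sub_one_eq_zero_or_isUnit {K R : Type*} [Field K] [CommRing R]
    [Algebra K R] [Algebra.FiniteType K R] {a : R}
    (h : ∀ N : ℕ, 0 < N → a ^ N - 1 = 0 ∨ IsUnit (a ^ N - 1)) : IsAlgebraic K a := by
  by_contra htr
  have hinj := transcendental_iff_injective.1 htr
  have hft : (Polynomial.aeval (R := K) a).toRingHom.FiniteType := by
    refine RingHom.FiniteType.of_comp_finiteType (f := algebraMap K (Polynomial K)) ?_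
    convert (RingHom.finiteType_algebraMap (A := K) (B := R)).2 inferInstance
    ext; simp
  obtain ⟨g, hg, hrange⟩ := PrimeSpectrum.exists_basicOpen_subset_range_comap hft hinj
  obtain ⟨N, θ, hN, hθ, hgθ⟩ := Polynomial.exists_pow_eq_one_aeval_ne_zero hg
  let p : PrimeSpectrum (Polynomial K) :=
    ⟨RingHom.ker (Polynomial.aeval (R := K) θ), RingHom.ker_isPrime _⟩
  obtain ⟨q, hq⟩ := hrange (show p ∈ PrimeSpectrum.basicOpen g from hgθ)
  have hmem : (Polynomial.X ^ N - 1 : Polynomial K) ∈ p.asIdeal := by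
    change Polynomial.aeval θ _ = 0
    simp [hθ]
  have hmem' : a ^ N - 1 ∈ q.asIdeal := by
    rw [← hq] at hmem
    simpa using hmem
  rcases h N hN with h0 | hu
  · refine Polynomial.X_pow_sub_C_ne_zero hN (1 : K) (hinj ?_)
    simpa using h0
  · exact q.isPrime.ne_top (Ideal.eq_top_of_isUnit_mem _ hmem' hu)

namespace AlgebraicGeometry

/-- The idempotents of the global sections of a connected scheme are trivial. -/
theorem Scheme.eq_zero_or_eq_one_of_isIdempotentElem {X : Scheme} [IsReduced X]
    [PreconnectedSpace X] {e : Γ(X, ⊤)} (he : IsIdempotentElem e) : e = 0 ∨ e = 1 := by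
  have hsup : X.basicOpen e ⊔ X.basicOpen (1 - e) = ⊤ := by
    have := X.basicOpen_add_le e (1 - e)
    rwa [add_sub_cancel, Scheme.basicOpen_one, top_le_iff] at this
  have hinf : X.basicOpen e ⊓ X.basicOpen (1 - e) = ⊥ := by
    rw [← Scheme.basicOpen_mul, he.mul_one_sub_self, Scheme.basicOpen_zero]
  have hclopen : IsClopen (X.basicOpen e : Set X) := by
    refine ⟨?_, (X.basicOpen e).isOpen⟩
    have hcoe : IsCompl (X.basicOpen e : Set X) (X.basicOpen (1 - e)) :=
      .of_eq (congrArg SetLike.coe hinf) (congrArg SetLike.coe hsup)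
    rw [← hcoe.symm.compl_eq]
    exact (X.basicOpen (1 - e)).isOpen.isClosed_compl
  rcases isClopen_iff.1 hclopen with h | h
  · left
    rw [← basicOpen_eq_bot_iff]
    exact TopologicalSpace.Opens.ext h
  · right
    rw [TopologicalSpace.Opens.coe_eq_univ.1 h, top_inf_eq, basicOpen_eq_bot_iff] at hinf
    exact (sub_eq_zero.1 hinf).symm

/-- On a scheme of finite type over a field `K`, a global section `a` such that each `a ^ N - 1`
with `0 < N` is zero or a unit is algebraic over `K`. -/
theorem exists_eval₂_eq_zero_of_pow_sub_one_eq_zero_or_isUnit {K : Type*} [Field K] {X : Scheme}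
    (f : X ⟶ Spec (CommRingCat.of K)) [LocallyOfFiniteType f] [QuasiCompact f] {a : Γ(X, ⊤)}
    (h : ∀ N : ℕ, 0 < N → a ^ N - 1 = 0 ∨ IsUnit (a ^ N - 1)) :
    ∃ P : Polynomial K, P ≠ 0 ∧
      P.eval₂ (f.appTop.hom.comp (Scheme.ΓSpecIso (CommRingCat.of K)).inv.hom) a = 0 := by
  set φ := f.appTop.hom.comp (Scheme.ΓSpecIso (CommRingCat.of K)).inv.hom
  have hloc (U : X.affineOpens) : ∃ P : Polynomial K, P ≠ 0 ∧
      X.presheaf.map (CategoryTheory.homOfLE (le_top : U.1 ≤ ⊤)).op (P.eval₂ φ a) = 0 := by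
    let ρ := (X.presheaf.map (CategoryTheory.homOfLE (le_top : U.1 ≤ ⊤)).op).hom
    have hft : (ρ.comp φ).FiniteType :=
      (f.finiteType_appLE (isAffineOpen_top _) U.2 le_top).comp
        (RingHom.FiniteType.of_surjective (Scheme.ΓSpecIso (CommRingCat.of K)).inv.hom
          (Scheme.ΓSpecIso (CommRingCat.of K)).symm.commRingCatIsoToRingEquiv.surjective)
    algebraize [ρ.comp φ]
    obtain ⟨P, hP, hP0⟩ := isAlgebraic_of_pow_sub_one_eq_zero_or_isUnit (K := K) (a := ρ a)
      fun N hN ↦ by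
        rw [← map_pow, ← map_one ρ, ← map_sub]
        exact (h N hN).imp (fun h ↦ by rw [h, map_zero]) (fun h ↦ h.map ρ)
    refine ⟨P, hP, ?_⟩
    change ρ _ = 0
    rw [Polynomial.hom_eval₂]
    exact hP0
  choose P hP hP0 using hloc
  have : CompactSpace X := (quasiCompact_iff_compactSpace f).1 inferInstance
  obtain ⟨s, hs, hcov⟩ := (isCompact_iff_finite_and_eq_biUnion_affineOpens (U := (⊤ : X.Opens))).1
    (by simpa using isCompact_univ)
  have := hs.fintype
  refine ⟨∏ U : s, P U, Finset.prod_ne_zero_iff.2 fun U _ ↦ hP U, ?_⟩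
  refine X.sheaf.eq_of_locally_eq' (fun U : s ↦ U.1.1) ⊤
    (fun U ↦ CategoryTheory.homOfLE le_top) ?_ _ _ fun U ↦ ?_
  · rw [hcov]
    exact iSup₂_le fun U hU ↦ le_iSup (fun U : s ↦ U.1.1) ⟨U, hU⟩
  · change X.presheaf.map _ _ = X.presheaf.map _ _
    rw [map_zero, Polynomial.eval₂_finsetProd, map_prod]
    exact Finset.prod_eq_zero (Finset.mem_univ U) (hP0 U)

end AlgebraicGeometry

/-- **Lemma 4.1 (existence of a largest ground field).**
Let `l` be a field and `X` a reduced connected scheme of finite type over `l`.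
Then the ring `A = O_X(X)` of global sections contains a largest subfield:
there is a subring `k` of `A` which is a field and which contains every subring
of `A` that is a field.  In particular, the range of any ring homomorphism from a
field into `A` is contained in `k`. -/
theorem exists_maximal_subfield_of_global_sections
    {l : Type} [Field l] (X : Scheme.{0}) [IsReduced X] [ConnectedSpace X]
    (f : X ⟶ Spec (CommRingCat.of l))
    [LocallyOfFiniteType f] [QuasiCompact f] :
    ∃ k : Subring (X.presheaf.obj (op ⊤)),
      IsField k ∧
      (∀ k' : Subring (X.presheaf.obj (op ⊤)), IsField k' → k' ≤ k) ∧
      (∀ (F : Type) (_ : Field F) (g : F →+* X.presheaf.obj (op ⊤)), g.range ≤ k) := by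
  let φ : l →+* Γ(X, ⊤) := f.appTop.hom.comp (Scheme.ΓSpecIso (CommRingCat.of l)).inv.hom
  algebraize [φ]
  have hmem {a : Γ(X, ⊤)} (h : ∀ N : ℕ, 0 < N → a ^ N - 1 = 0 ∨ IsUnit (a ^ N - 1)) :
      a ∈ integralClosure l Γ(X, ⊤) := by
    rw [mem_integralClosure_iff, ← isAlgebraic_iff_isIntegral]
    exact exists_eval₂_eq_zero_of_pow_sub_one_eq_zero_or_isUnit f h
  have hhom (F : Type) (_ : Field F) (g : F →+* Γ(X, ⊤)) :
      g.range ≤ (integralClosure l Γ(X, ⊤)).toSubring := by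
    rintro _ ⟨x, rfl⟩
    refine hmem fun N hN ↦ ?_
    rw [← map_pow, ← map_one g, ← map_sub]
    rcases eq_or_ne (x ^ N - 1) 0 with h0 | h0
    · exact .inl (by rw [h0, map_zero])
    · exact .inr (h0.isUnit.map g)
  refine ⟨(integralClosure l Γ(X, ⊤)).toSubring, ?_, fun k' hk' ↦ ?_, hhom⟩
  · have : Nonempty (⊤ : X.Opens) := ⟨⟨Classical.arbitrary X, trivial⟩⟩
    have : Nontrivial (integralClosure l Γ(X, ⊤)) := 
      (integralClosure l Γ(X, ⊤)).val.toRingHom.domain_nontrivial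
    have : _root_.IsReduced (integralClosure l Γ(X, ⊤)) :=
      isReduced_of_injective (integralClosure l Γ(X, ⊤)).val Subtype.val_injective
    refine isField_of_isIntegral_of_isIdempotentElem (K := l)
      (B := integralClosure l Γ(X, ⊤)) fun e he ↦ ?_
    have he' : IsIdempotentElem (e : Γ(X, ⊤)) := congrArg Subtype.val he
    exact (Scheme.eq_zero_or_eq_one_of_isIdempotentElem he').imp
      (fun h ↦ Subtype.ext h) (fun h ↦ Subtype.ext h)
  · have := hhom k' hk'.toField k'.subtype
    rwa [Subring.range_subtype] at this
end

section
/- Let A be a commutative ring which is a finite type algebra over some field and whose prime spectrum is connected (in particular nonempty), let l be a perfect field, and let φ : l → A be a ring homomorphism. Then there exist a field k, a ring homomorphism ι : l → k, and a ring homomorphism ψ : k → A such that ψ ∘ ι = φ and A is a finite type k-algebra via ψ. -/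
section

open Polynomial

/-- Infinitely many elements of an algebraically closed field are integral over `ℤ`. -/
theorem infinite_integralClosure_int (K : Type*) [Field K] [IsAlgClosed K] :
    Infinite (integralClosure ℤ K) := by
  by_contra hfin
  rw [not_infinite_iff_finite] at hfin
  have := Fintype.ofFinite (integralClosure ℤ K)
  set f : (integralClosure ℤ K)[X] := ∏ a, (X - C a) + 1 with hf
  have hprod : (∏ a : integralClosure ℤ K, (X - C a)).Monic :=
    monic_prod_of_monic _ _ fun a _ ↦ monic_X_sub_C a
  have hdeg : (1 : (integralClosure ℤ K)[X]).degree <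
      (∏ a : integralClosure ℤ K, (X - C a)).degree := by
    rw [degree_prod_of_monic _ _ fun a _ ↦ monic_X_sub_C a]
    simp [degree_one, Fintype.card_pos]
  have hmonic : f.Monic := hprod.add_of_left hdeg
  obtain ⟨x, hx⟩ := IsAlgClosed.exists_aeval_eq_zero_of_injective K
    Subtype.val_injective f (by
      rw [hf, degree_add_eq_left_of_degree_lt hdeg]
      exact (lt_of_le_of_lt (by simp) hdeg).ne')
  have hxint : IsIntegral ℤ x := isIntegral_trans x ⟨f, hmonic, hx⟩
  have h0 : aeval x (∏ a : integralClosure ℤ K, (X - C a)) = 0 := by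
    rw [map_prod]
    refine Finset.prod_eq_zero (Finset.mem_univ ⟨x, hxint⟩) ?_
    simp
  simp [hf, h0] at hx

/-- A dense constructible subset of an irreducible space contains a nonempty open set. -/
theorem exists_isOpen_subset_of_isConstructible_of_dense {X : Type*} [TopologicalSpace X]
    [IrreducibleSpace X] {s : Set X} (hs : Topology.IsConstructible s) (hd : Dense s) :
    ∃ U ⊆ s, IsOpen U ∧ U.Nonempty := by
  have key : (∃ U ⊆ s, IsOpen U ∧ U.Nonempty) ∨ (∃ U ⊆ sᶜ, IsOpen U ∧ U.Nonempty) := by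
    clear hd
    induction hs using Topology.IsConstructible.empty_union_induction with
    | open_retrocompact U hU _ =>
      rcases U.eq_empty_or_nonempty with rfl | hne
      · exact .inr ⟨Set.univ, by simp, isOpen_univ, Set.univ_nonempty⟩
      · exact .inl ⟨U, subset_rfl, hU, hne⟩
    | union s _ t _ hs ht =>
      by_cases hs' : ∃ U ⊆ s, IsOpen U ∧ U.Nonempty
      · obtain ⟨U, hUs, hU⟩ := hs'
        exact .inl ⟨U, hUs.trans Set.subset_union_left, hU⟩
      by_cases ht' : ∃ U ⊆ t, IsOpen U ∧ U.Nonempty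
      · obtain ⟨U, hUt, hU⟩ := ht'
        exact .inl ⟨U, hUt.trans Set.subset_union_right, hU⟩
      obtain ⟨U, hUs, hU, hUne⟩ := hs.resolve_left hs'
      obtain ⟨V, hVt, hV, hVne⟩ := ht.resolve_left ht'
      refine .inr ⟨U ∩ V, ?_, hU.inter hV, nonempty_preirreducible_inter hU hV hUne hVne⟩
      rw [Set.compl_union]
      exact Set.inter_subset_inter hUs hVt
    | compl s _ hs => rwa [compl_compl, or_comm]
  refine key.resolve_right ?_
  rintro ⟨U, hUs, hU, hne⟩
  obtain ⟨x, hxU, hxs⟩ := hd.inter_open_nonempty U hU hne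
  exact hUs hxU hxs

/-- Every subfield of a finite type `F`-algebra consists of elements integral over `F`. -/
theorem isIntegral_of_ringHom_field {F R l : Type*} [Field F] [CommRing R] [Algebra F R]
    [Algebra.FiniteType F R] [Field l] (φ : l →+* R) (x : l) : IsIntegral F (φ x) := by
  by_contra hx
  have hinj : Function.Injective (aeval (R := F) (φ x)).toRingHom := by
    rw [injective_iff_map_eq_zero]
    intro p hp
    by_contra hp0
    exact hx (isAlgebraic_iff_isIntegral.mp ⟨p, hp0, hp⟩)
  have hZ (h : ℤ[X]) (hh : h.Monic) : IsUnit (aeval (φ x) h) := by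
    have : aeval (φ x) h = φ (aeval x h) := by
      rw [← RingHom.toIntAlgHom_apply φ, ← RingHom.toIntAlgHom_apply φ, aeval_algHom_apply]
    rw [this]
    refine IsUnit.map φ (isUnit_iff_ne_zero.mpr fun h0 ↦ hx ?_)
    have : IsIntegral ℤ (φ x) := ⟨h, hh, by rw [← aeval_def, this, h0, map_zero]⟩
    exact this.tower_top
  have hft : (aeval (R := F) (φ x)).toRingHom.FiniteType :=
    RingHom.FiniteType.of_comp_finiteType (f := algebraMap F F[X]) (by
      convert! RingHom.finiteType_algebraMap.mpr ‹Algebra.FiniteType F R›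
      exact (aeval (R := F) (φ x)).comp_algebraMap)
  have hdense : DenseRange (PrimeSpectrum.comap (aeval (R := F) (φ x)).toRingHom) := by
    rw [PrimeSpectrum.denseRange_comap_iff_ker_le_nilRadical,
      (RingHom.injective_iff_ker_eq_bot _).mp hinj]
    exact bot_le
  obtain ⟨U, hUs, hU, y, hy⟩ := exists_isOpen_subset_of_isConstructible_of_dense
    (PrimeSpectrum.isConstructible_range_comap
      (RingHom.FinitePresentation.of_finiteType.mp hft)) hdense
  obtain ⟨_, ⟨g, rfl⟩, hyg, hgU⟩ :=
    PrimeSpectrum.isTopologicalBasis_basic_opens.exists_subset_of_mem_open hy hU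
  have hg0 : g ≠ 0 := by
    rintro rfl
    simp at hyg
  let K := AlgebraicClosure F
  have hroot (a : integralClosure ℤ K) : aeval (a : K) g = 0 := by
    by_contra ha
    obtain ⟨h, hmonic, hh⟩ := a.2
    let q : PrimeSpectrum F[X] := ⟨RingHom.ker (aeval (R := F) (a : K)), RingHom.ker_isPrime _⟩
    obtain ⟨r, hr⟩ := hUs (hgU (show q ∈ PrimeSpectrum.basicOpen g from ha))
    have hq : h.map (Int.castRingHom F) ∈ q.asIdeal := by
      change aeval (a : K) (h.map (algebraMap ℤ F)) = 0
      rw [aeval_map_algebraMap]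
      exact hh
    rw [← hr] at hq
    change aeval (φ x) (h.map (algebraMap ℤ F)) ∈ r.asIdeal at hq
    rw [aeval_map_algebraMap] at hq
    exact r.isPrime.ne_top (Ideal.eq_top_of_isUnit_mem _ hq (hZ h hmonic))
  have := infinite_integralClosure_int K
  have hsub : (integralClosure ℤ K : Set K) ⊆ g.rootSet K := fun a ha ↦
    (mem_rootSet.mpr ⟨hg0, hroot ⟨a, ha⟩⟩)
  exact (Set.infinite_coe_iff.mp this) ((rootSet_finite g K).subset hsub)

/-- The integral closure of a field in a reduced connected algebra is a field. -/
theorem isField_integralClosure (F R : Type*) [Field F] [CommRing R] [Algebra F R] [IsReduced R]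
    [ConnectedSpace (PrimeSpectrum R)] : IsField (integralClosure F R) := by
  have hnt : Nontrivial R := by
    rw [← PrimeSpectrum.nonempty_iff_nontrivial]; infer_instance
  have hidem (e : R) (he : e * e = e) : e = 0 ∨ e = 1 := by
    have hcl : IsClopen (PrimeSpectrum.basicOpen e : Set (PrimeSpectrum R)) :=
      PrimeSpectrum.isClopen_iff.mpr ⟨e, he, rfl⟩
    rcases isClopen_iff.mp hcl with h | h
    · left
      have : PrimeSpectrum.basicOpen e = ⊥ := TopologicalSpace.Opens.ext h
      exact (PrimeSpectrum.basicOpen_eq_bot_iff e).mp this |>.eq_zero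
    · right
      have htop : PrimeSpectrum.basicOpen e = ⊤ := TopologicalSpace.Opens.ext h
      have hbot : PrimeSpectrum.basicOpen (1 - e) = ⊥ := by
        rw [← top_inf_eq (PrimeSpectrum.basicOpen (1 - e)), ← htop, ← PrimeSpectrum.basicOpen_mul,
          mul_sub, he, mul_one, sub_self, PrimeSpectrum.basicOpen_zero]
      exact (sub_eq_zero.mp ((PrimeSpectrum.basicOpen_eq_bot_iff _).mp hbot).eq_zero).symm
  have hred : IsReduced (integralClosure F R) :=
    isReduced_of_injective (integralClosure F R).val Subtype.val_injective
  refine ⟨⟨0, 1, zero_ne_one⟩, mul_comm, fun {x} hx ↦ ?_⟩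
  have hfin : Module.Finite F (Algebra.adjoin F {x}) := Algebra.finite_adjoin_simple_of_isIntegral
    (Algebra.IsIntegral.isIntegral x)
  have : IsArtinianRing (Algebra.adjoin F {x}) := IsArtinianRing.of_finite F _
  obtain ⟨n, y, hy⟩ := IsArtinian.exists_pow_succ_smul_dvd
    (⟨x, Algebra.self_mem_adjoin_singleton F x⟩ : Algebra.adjoin F {x})
    (1 : Algebra.adjoin F {x})
  have hy' : x ^ (n + 1) * y.1 = x ^ n := by simpa using congr_arg Subtype.val hy
  have hxy : x * (1 - x * y.1) = 0 := by
    refine pow_eq_zero_iff (n := n + 1) (by simp) |>.mp ?_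
    rw [mul_pow]
    linear_combination (- x * (1 - x * y.1) ^ n) * hy'
  refine ⟨y.1, ?_⟩
  rcases hidem (x * y.1 : integralClosure F R) (by
    norm_cast; linear_combination (-y.1) * hxy) with h | h
  · refine absurd ?_ hx
    have h : x * y.1 = 0 := by exact_mod_cast h
    linear_combination hxy + x * h
  · exact_mod_cast h

/-- A field mapping to a reduced connected algebra `R` of finite type over a field maps through a
field over which `R` is of finite type. -/
theorem exists_field_finiteType_of_isReduced {F R l : Type} [Field F] [CommRing R] [Algebra F R]
    [Algebra.FiniteType F R] [IsReduced R] [ConnectedSpace (PrimeSpectrum R)]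
    [Field l] (φ : l →+* R) :
    ∃ (k : Type) (_ : Field k) (ι : l →+* k) (ψ : k →+* R), ψ.comp ι = φ ∧ ψ.FiniteType := by
  refine ⟨integralClosure F R, (isField_integralClosure F R).toField,
    φ.codRestrict (integralClosure F R) (isIntegral_of_ringHom_field φ),
    algebraMap (integralClosure F R) R, rfl, ?_⟩
  exact RingHom.finiteType_algebraMap.mpr (.of_restrictScalars_finiteType F _ R)

/-- Being of finite type can be checked modulo a finitely generated nilpotent ideal. -/
theorem finiteType_of_quotient_nilpotent {k A : Type*} [CommRing k] [CommRing A] (f : k →+* A)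
    {I : Ideal A} (hI : IsNilpotent I) (hfg : I.FG)
    (h : ((Ideal.Quotient.mk I).comp f).FiniteType) : f.FiniteType := by
  algebraize [f]
  have h' : Algebra.FiniteType k (A ⧸ I) := h
  obtain ⟨s, hs⟩ := h'.out
  obtain ⟨t, ht⟩ := hfg
  let σ : A ⧸ I → A := Function.surjInv Ideal.Quotient.mk_surjective
  have hσ (y) : Ideal.Quotient.mk I (σ y) = y := Function.surjInv_eq _ y
  let s' : Set A := σ '' s
  let B := Algebra.adjoin k (s' ∪ t)
  have hBfg : B.FG := ⟨((s.finite_toSet.image σ).union t.finite_toSet).toFinset, by simp [B, s']⟩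
  have hB0 (x : A) : ∃ b ∈ B, x - b ∈ I := by
    have hmap : (Algebra.adjoin k s').map (Ideal.Quotient.mkₐ k I) = ⊤ := by
      rw [AlgHom.map_adjoin, ← hs, ← Set.image_comp]
      congr 1
      convert Set.image_id _
      ext y
      simp [hσ]
    obtain ⟨b, hb, hbx⟩ : Ideal.Quotient.mk I x ∈ (Algebra.adjoin k s').map
        (Ideal.Quotient.mkₐ k I) := hmap ▸ Algebra.mem_top
    exact ⟨b, Algebra.adjoin_mono Set.subset_union_left hb, Ideal.Quotient.eq.mp hbx.symm⟩
  have hB1 (z : A) (hz : z ∈ I) : ∃ c ∈ B, z - c ∈ I ^ 2 := by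
    rw [← ht] at hz
    induction hz using Submodule.span_induction with
    | mem z hz => exact ⟨z, Algebra.subset_adjoin (.inr hz), by simp⟩
    | zero => exact ⟨0, B.zero_mem, by simp⟩
    | add y z _ _ hy hz =>
      obtain ⟨b, hb, hb'⟩ := hy
      obtain ⟨c, hc, hc'⟩ := hz
      exact ⟨b + c, B.add_mem hb hc, by convert add_mem hb' hc' using 1; ring⟩
    | smul a z hz' hz =>
      obtain ⟨c, hc, hc'⟩ := hz
      obtain ⟨b, hb, hb'⟩ := hB0 a
      have hzI : z ∈ I := ht ▸ hz'
      refine ⟨b * c, B.mul_mem hb hc, ?_⟩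
      have h1 : (a - b) * z ∈ I ^ 2 := pow_two I ▸ Ideal.mul_mem_mul hb' hzI
      have h2 : b * (z - c) ∈ I ^ 2 := Ideal.mul_mem_left _ _ hc'
      convert add_mem h1 h2 using 1
      simp only [smul_eq_mul]
      ring
  have hBn (n : ℕ) (x : A) (hx : x ∈ I ^ n) : ∃ b ∈ B, x - b ∈ I ^ (n + 1) := by
    induction n generalizing x with
    | zero => simpa using hB0 x
    | succ n ih =>
      rw [pow_succ] at hx
      induction hx using Submodule.mul_induction_on' with
      | mem_mul_mem y hy z hz =>
        obtain ⟨b, hb, hb'⟩ := ih y hy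
        obtain ⟨c, hc, hc'⟩ := hB1 z hz
        have hbI : b ∈ I ^ n := by
          simpa using sub_mem hy (Ideal.pow_le_pow_right n.le_succ hb')
        refine ⟨b * c, B.mul_mem hb hc, ?_⟩
        have h1 : (y - b) * z ∈ I ^ (n + 1 + 1) := pow_succ I (n + 1) ▸ Ideal.mul_mem_mul hb' hz
        have h2 : b * (z - c) ∈ I ^ (n + 1 + 1) := pow_add I n 2 ▸ Ideal.mul_mem_mul hbI hc'
        convert add_mem h1 h2 using 1
        ring
      | add y _ z _ hy hz =>
        obtain ⟨b, hb, hb'⟩ := hy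
        obtain ⟨c, hc, hc'⟩ := hz
        exact ⟨b + c, B.add_mem hb hc, by convert add_mem hb' hc' using 1; ring⟩
  have hall (n : ℕ) (x : A) : ∃ b ∈ B, x - b ∈ I ^ n := by
    induction n with
    | zero => exact ⟨0, B.zero_mem, by simp⟩
    | succ n ih =>
      obtain ⟨b, hb, hb'⟩ := ih
      obtain ⟨c, hc, hc'⟩ := hBn n _ hb'
      exact ⟨b + c, B.add_mem hb hc, by rwa [← sub_sub]⟩
  obtain ⟨n, hn⟩ := hI
  have htop : B = ⊤ := by
    refine Algebra.eq_top_iff.mpr fun x ↦ ?_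
    obtain ⟨b, hb, hb'⟩ := hall n x
    rw [hn, Ideal.zero_eq_bot, Ideal.mem_bot, sub_eq_zero] at hb'
    exact hb' ▸ hb
  exact ⟨htop ▸ hBfg⟩

/-- A surjection from a ring of characteristic `p` onto a field, whose kernel is killed by
Frobenius, has a section fixing all `p`-th powers. -/
theorem exists_section_of_pow_eq_zero {B K : Type*} [CommRing B] [Field K] (p : ℕ)
    [hp : Fact p.Prime] [CharP B p] (π : B →+* K) (hπ : Function.Surjective π)
    (hker : ∀ x, π x = 0 → x ^ p = 0) :
    ∃ σ : K →+* B, π.comp σ = RingHom.id K ∧ ∀ b, σ (π (b ^ p)) = b ^ p := by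
  obtain ⟨S, hS0, hSmax⟩ := zorn_le_nonempty₀
    {S : Subring B | (frobenius B p).range ≤ S ∧ ∀ x ∈ S, π x = 0 → x = 0} (by
      intro c hc hchain S₀ hS₀
      have hmem {x : B} : x ∈ sSup c ↔ ∃ S ∈ c, x ∈ S :=
        Subring.mem_sSup_of_directedOn ⟨S₀, hS₀⟩ hchain.directedOn
      refine ⟨sSup c, ⟨(hc hS₀).1.trans (le_sSup hS₀), fun x hx ↦ ?_⟩, fun S hS ↦ le_sSup hS⟩
      obtain ⟨S, hS, hxS⟩ := hmem.mp hx
      exact (hc hS).2 x hxS)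
    (frobenius B p).range ⟨le_rfl, by
      rintro _ ⟨x, rfl⟩ hx
      rw [frobenius_def] at hx ⊢
      exact hker x (pow_eq_zero_iff hp.1.ne_zero |>.mp (by rwa [map_pow] at hx))⟩
  have hpow (b : B) : b ^ p ∈ S := hS0 ⟨b, rfl⟩
  have hinj : Function.Injective (π.comp S.subtype) := by
    rw [injective_iff_map_eq_zero]
    exact fun x hx ↦ Subtype.ext (hSmax.1.2 x x.2 hx)
  have hsurj : Function.Surjective (π.comp S.subtype) := by
    by_contra hns
    have : ∃ b, ∀ s ∈ S, π s ≠ π b := by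
      simp only [Function.Surjective, not_forall] at hns
      obtain ⟨x, hx⟩ := hns
      obtain ⟨b, rfl⟩ := hπ x
      exact ⟨b, fun s hs h ↦ hx ⟨⟨s, hs⟩, h⟩⟩
    obtain ⟨b, hb⟩ := this
    have hfield : IsField S := by
      have : Nontrivial S := (π.comp S.subtype).domain_nontrivial
      refine ⟨⟨0, 1, zero_ne_one⟩, mul_comm, fun {a} ha ↦ ?_⟩
      have ha' : π a ≠ 0 := fun h ↦ ha (Subtype.ext (hSmax.1.2 a a.2 h))
      obtain ⟨c, hc⟩ := hπ (π a)⁻¹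
      refine ⟨a ^ (p - 1) * ⟨c ^ p, hpow c⟩, hinj ?_⟩
      have : π (a : B) * (π a ^ (p - 1) * (π a)⁻¹ ^ p) = 1 := by
        rw [← mul_assoc, ← pow_succ', Nat.sub_add_cancel hp.1.one_le, ← mul_pow,
          mul_inv_cancel₀ ha', one_pow]
      simpa [hc] using this
    let := hfield.toField
    let : Algebra S K := (π.comp S.subtype).toAlgebra
    have hirr : Irreducible (X ^ p - C (⟨b ^ p, hpow b⟩ : S)) := by
      refine X_pow_sub_C_irreducible_of_prime hp.1 fun s hs ↦ hb s s.2 ?_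
      have : CharP K p := charP_of_injective_ringHom (f := π.comp S.subtype) hinj p
      apply frobenius_inj K p
      have := congr_arg (fun s : S ↦ π s) hs
      simpa [frobenius_def] using this
    let S' := (Algebra.adjoin S {b}).toSubring
    have hS' : S ≤ S' := fun s hs ↦ (Algebra.adjoin S {b}).algebraMap_mem ⟨s, hs⟩
    have hmem : S' ∈ {S : Subring B | (frobenius B p).range ≤ S ∧ ∀ x ∈ S, π x = 0 → x = 0} := by
      refine ⟨hS0.trans hS', fun x hx hx0 ↦ ?_⟩
      change x ∈ Algebra.adjoin S {b} at hx
      rw [Algebra.adjoin_singleton_eq_range_aeval] at hx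
      obtain ⟨f, rfl⟩ := hx
      have hfb : aeval (π b) f = 0 := by
        rw [← hx0]
        simp [aeval_def, hom_eval₂]
        rfl
      have hdvd : X ^ p - C (⟨b ^ p, hpow b⟩ : S) ∣ f := by
        have hm := minpoly.eq_of_irreducible_of_monic hirr (x := π b) (by
          simp [RingHom.algebraMap_toAlgebra]) (monic_X_pow_sub_C _ hp.1.ne_zero)
        rw [hm]
        exact minpoly.dvd _ _ hfb
      obtain ⟨q, rfl⟩ := hdvd
      have : aeval b (X ^ p - C (⟨b ^ p, hpow b⟩ : S)) = 0 := by
        rw [map_sub, map_pow, aeval_X, aeval_C]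
        exact sub_self (b ^ p)
      simp [this]
    have hbS : b ∈ S := hSmax.2 hmem hS' (Algebra.self_mem_adjoin_singleton S b)
    exact hb b hbS rfl
  let e := RingEquiv.ofBijective _ ⟨hinj, hsurj⟩
  refine ⟨S.subtype.comp e.symm.toRingHom, RingHom.ext fun x ↦ e.apply_symm_apply x, fun b ↦ ?_⟩
  exact congr_arg Subtype.val (e.symm_apply_apply ⟨b ^ p, hpow b⟩)

/-- Every field extension of a perfect field is formally smooth. -/
theorem formallySmooth_of_perfectField (l K : Type*) [Field l] [PerfectField l] [Field K]
    [Algebra l K] : Algebra.FormallySmooth l K := by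
  obtain ⟨p, hp⟩ := CharP.exists l
  rcases CharP.char_is_prime_or_zero l p with hprime | rfl
  · have : Fact p.Prime := ⟨hprime⟩
    let f : MvPolynomial K l →ₐ[l] K := MvPolynomial.aeval id
    have hf : Function.Surjective f := fun x ↦ ⟨.X x, by simp [f]⟩
    have hf' : Function.Surjective f.kerSquareLift := fun x ↦ by
      obtain ⟨y, rfl⟩ := hf x
      exact ⟨Ideal.Quotient.mk _ y, rfl⟩
    have : Nontrivial (MvPolynomial K l ⧸ RingHom.ker f.toRingHom ^ 2) :=
      f.kerSquareLift.toRingHom.domain_nontrivial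
    have : CharP (MvPolynomial K l ⧸ RingHom.ker f.toRingHom ^ 2) p :=
      charP_of_injective_algebraMap (algebraMap l _).injective p
    obtain ⟨σ, hσ, hσp⟩ := exists_section_of_pow_eq_zero p f.kerSquareLift.toRingHom hf' (by
      intro x hx
      refine pow_eq_zero_of_le hprime.two_le ?_
      obtain ⟨y, rfl⟩ := Ideal.Quotient.mk_surjective x
      rw [← map_pow, Ideal.Quotient.eq_zero_iff_mem]
      exact Ideal.pow_mem_pow (show f y = 0 from hx) 2)
    refine .of_split f { σ with commutes' := fun c ↦ ?_ } (AlgHom.ext fun x ↦ RingHom.congr_fun hσ x)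
    obtain ⟨d, rfl⟩ := surjective_frobenius l p c
    have := hσp (algebraMap l _ d)
    rw [← map_pow] at this
    exact (congr_arg σ (f.kerSquareLift.commutes (d ^ p)).symm).trans this
  · have : CharZero l := CharP.charP_to_charZero l
    obtain ⟨s, hs⟩ := exists_isTranscendenceBasis l K
    have : Algebra.IsAlgebraic (IntermediateField.adjoin l (Set.range ((↑) : s → K))) K :=
      hs.isAlgebraic_field
    exact .of_algebraicIndependent_of_isSeparable hs.1

end

/-- **Corollary 4.3 (affine form).**
Let `A` be a commutative ring of finite type over some field whose prime spectrum is
connected, let `l` be a perfect field and `φ : l → A` a ring homomorphism.  Then `φ`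
factors as `ψ ∘ ι` where `ι : l → k` and `ψ : k → A` are ring homomorphisms, `k` is a
field, and `A` is of finite type over `k` via `ψ`. -/
theorem ringHom_from_perfect_field_factors_through_finiteType
    {A : Type} [CommRing A]
    (F₀ : Type) [Field F₀] [Algebra F₀ A] [Algebra.FiniteType F₀ A]
    [ConnectedSpace (PrimeSpectrum A)]
    {l : Type} [Field l] [PerfectField l] (φ : l →+* A) :
    ∃ (k : Type) (fk : Field k),
      letI : Field k := fk
      ∃ (ι : l →+* k) (ψ : k →+* A),
        ψ.comp ι = φ ∧
        (letI : Algebra k A := ψ.toAlgebra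
         Algebra.FiniteType k A) := by
  have hnoeth : IsNoetherianRing A := Algebra.FiniteType.isNoetherianRing F₀ A
  have hnil : IsNilpotent (nilradical A) := IsNoetherianRing.isNilpotent_nilradical A
  have hred : IsReduced (A ⧸ nilradical A) :=
    (Ideal.isRadical_iff_quotient_reduced _).mp (Ideal.radical_isRadical _)
  have hhomeo : IsHomeomorph (PrimeSpectrum.comap (Ideal.Quotient.mk (nilradical A))) :=
    PrimeSpectrum.isHomeomorph_comap _
      (fun x ↦ ⟨1, one_pos, by simpa using Ideal.Quotient.mk_surjective x⟩) (by rw [Ideal.mk_ker])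
  have hconn : ConnectedSpace (PrimeSpectrum (A ⧸ nilradical A)) :=
    hhomeo.homeomorph.symm.surjective.connectedSpace hhomeo.homeomorph.symm.continuous
  obtain ⟨k, fk, ι, j, hj, hft⟩ := exists_field_finiteType_of_isReduced (F := F₀)
    ((Ideal.Quotient.mk (nilradical A)).comp φ)
  let : Algebra l A := φ.toAlgebra
  let : Algebra l k := ι.toAlgebra
  have := formallySmooth_of_perfectField l k
  let g : k →ₐ[l] A ⧸ nilradical A := { j with commutes' := fun c ↦ RingHom.congr_fun hj c }
  let ψ := Algebra.FormallySmooth.lift _ hnil g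
  refine ⟨k, fk, ι, ψ.toRingHom, ψ.comp_algebraMap, ?_⟩
  refine finiteType_of_quotient_nilpotent ψ.toRingHom hnil (IsNoetherian.noetherian _) ?_
  convert! hft
  exact RingHom.ext fun x ↦ Algebra.FormallySmooth.mk_lift _ hnil g x
end

section
/- Let k be a field of characteristic zero and let A be a commutative k-algebra of finite type which is smooth over k (i.e., formally smooth and of finite presentation). Then there exist an intermediate field m with ℚ ⊆ m ⊆ k, finitely generated as a field extension of ℚ, and a smooth m-algebra B of finite type, together with an isomorphism of k-algebras A ≅ k ⊗_m B. -/
open TensorProduct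

/-- A finitely generated subalgebra of a field `k` over a field `F` is contained in an intermediate
field that is finitely generated as a field extension of `F`. -/
theorem Subalgebra.FG.exists_le_toSubalgebra_fg {F k : Type*} [Field F] [Field k] [Algebra F k]
    {S : Subalgebra F k} (hS : S.FG) :
    ∃ m : IntermediateField F k, m.FG ∧ S ≤ m.toSubalgebra := by
  obtain ⟨s, rfl⟩ := hS
  exact ⟨IntermediateField.adjoin F s, ⟨s, rfl⟩,
    IntermediateField.algebra_adjoin_le_adjoin F (s : Set k)⟩

/-- **Theorem 3.1 (affine form), smooth case.**
Let `k` be a field of characteristic zero and `A` a smooth commutative `k`-algebra of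
finite type.  Then there is an intermediate field `ℚ ⊆ m ⊆ k`, finitely generated as a
field extension of `ℚ`, and a smooth finite type `m`-algebra `B` such that
`A ≅ k ⊗_m B` as `k`-algebras. -/
theorem descend_smooth_algebra_to_finitely_generated_subfield_of_rat
    {k : Type} [Field k] [CharZero k]
    (A : Type) [CommRing A] [Algebra k A] [Algebra.FiniteType k A]
    [Algebra.Smooth k A] :
    ∃ m : IntermediateField ℚ k, m.FG ∧
      ∃ (B : Type) (cB : CommRing B),
        letI : CommRing B := cB
        ∃ aB : Algebra m B,
          letI : Algebra m B := aB
          Algebra.FiniteType m B ∧ Algebra.Smooth m B ∧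
            Nonempty (A ≃ₐ[k] (k ⊗[m] B)) := by
  obtain ⟨A₀, B₀, _, _, hA₀, _, ⟨e⟩⟩ := Algebra.Smooth.exists_subalgebra_fg ℚ k A
  obtain ⟨m, hm, hle⟩ := hA₀.exists_le_toSubalgebra_fg
  let : Algebra A₀ m := (Subalgebra.inclusion hle).toRingHom.toAlgebra
  have : IsScalarTower A₀ m k := .of_algebraMap_eq fun _ ↦ rfl
  exact ⟨m, hm, m ⊗[A₀] B₀, inferInstance, inferInstance, inferInstance, inferInstance,
    ⟨e.trans (Algebra.TensorProduct.cancelBaseChange A₀ m k k B₀).symm⟩⟩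
end
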